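/- Let d ≥ 2 be an integer and α ∈ (0,2). Then α · (B(d/2-α/2, α/2)/B(d/2, α/2)) · ∫_0^1 s^{α-1} (1 - I(s^2; d/2-α/2, α/2)) ds = 1; that is, f_{R_v}(s) = α (B(d/2-α/2, α/2)/B(d/2, α/2)) s^{α-1} (1 - I(s^2; d/2-α/2, α/2)) is a probability density on (0,1). -/

import Mathlib

open Real MeasureTheory

/-- Beta function B(z,w) = Γ(z)Γ(w)/Γ(z+w). -/
noncomputable def betaFn (z w : ℝ) : ℝ :=
  Real.Gamma z * Real.Gamma w / Real.Gamma (z + w)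

/-- Regularized incomplete Beta function I(x; z, w). -/
noncomputable def regIncBeta (x z w : ℝ) : ℝ :=
  (∫ u in (0:ℝ)..x, u ^ (z - 1) * (1 - u) ^ (w - 1)) / betaFn z w

lemma betaFn_pos {z w : ℝ} (hz : 0 < z) (hw : 0 < w) : 0 < betaFn z w :=
  ProbabilityTheory.beta_pos hz hw

lemma ofReal_rpow_mul_one_sub_rpow {z w u : ℝ} (hu : u ∈ Set.Ioc (0:ℝ) 1) :
    ((u ^ (z - 1) * (1 - u) ^ (w - 1) : ℝ) : ℂ) =
      (u : ℂ) ^ ((z : ℂ) - 1) * (1 - (u : ℂ)) ^ ((w : ℂ) - 1) := by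
  push_cast [Complex.ofReal_cpow hu.1.le, Complex.ofReal_cpow (sub_nonneg.2 hu.2)]
  rfl

lemma intervalIntegrable_rpow_mul_one_sub_rpow {z w : ℝ} (hz : 0 < z) (hw : 0 < w) :
    IntervalIntegrable (fun u : ℝ => u ^ (z - 1) * (1 - u) ^ (w - 1)) volume 0 1 := by
  have h := Complex.betaIntegral_convergent (u := z) (v := w) (by simpa) (by simpa)
  rw [intervalIntegrable_iff_integrableOn_Ioc_of_le zero_le_one] at h ⊢
  refine (integrableOn_congr_fun (fun u hu => ?_) measurableSet_Ioc).1 h.re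
  simp only [← ofReal_rpow_mul_one_sub_rpow hu, RCLike.re_to_complex, Complex.ofReal_re]

lemma integral_rpow_mul_one_sub_rpow {z w : ℝ} (hz : 0 < z) (hw : 0 < w) :
    ∫ u in (0:ℝ)..1, u ^ (z - 1) * (1 - u) ^ (w - 1) = betaFn z w := by
  have h : betaFn z w = (Complex.betaIntegral z w).re :=
    ProbabilityTheory.beta_eq_betaIntegralReal z w hz hw
  rw [h, Complex.betaIntegral, ← Complex.ofReal_re (∫ u in (0:ℝ)..1, _),
    ← intervalIntegral.integral_ofReal]
  congr 1
  refine intervalIntegral.integral_congr_ae (Filter.Eventually.of_forall fun u hu => ?_)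
  rw [Set.uIoc_of_le zero_le_one] at hu
  exact ofReal_rpow_mul_one_sub_rpow hu

lemma hasDerivAt_integral_rpow_mul_one_sub_rpow {z w x : ℝ} (hz : 0 < z) (hw : 0 < w)
    (hx : x ∈ Set.Ioo (0:ℝ) 1) :
    HasDerivAt (fun y => ∫ u in (0:ℝ)..y, u ^ (z - 1) * (1 - u) ^ (w - 1))
      (x ^ (z - 1) * (1 - x) ^ (w - 1)) x := by
  refine intervalIntegral.integral_hasDerivAt_right
    ((intervalIntegrable_rpow_mul_one_sub_rpow hz hw).mono_set ?_) ?_ ?_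
  · rw [Set.uIcc_of_le hx.1.le, Set.uIcc_of_le zero_le_one]
    exact Set.Icc_subset_Icc_right hx.2.le
  · exact (Measurable.stronglyMeasurable (by fun_prop)).stronglyMeasurableAtFilter
  · exact (continuousAt_id.rpow_const (Or.inl hx.1.ne')).mul
      ((continuousAt_const.sub continuousAt_id).rpow_const (Or.inl (sub_pos.2 hx.2).ne'))

lemma continuousOn_integral_rpow_mul_one_sub_rpow_sq {z w : ℝ} (hz : 0 < z) (hw : 0 < w) :
    ContinuousOn (fun s : ℝ => ∫ u in (0:ℝ)..s ^ 2, u ^ (z - 1) * (1 - u) ^ (w - 1))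
      (Set.Icc 0 1) := by
  have h := intervalIntegral.continuousOn_primitive_interval' (μ := volume)
    (intervalIntegrable_rpow_mul_one_sub_rpow hz hw) Set.left_mem_uIcc
  rw [Set.uIcc_of_le zero_le_one] at h
  exact h.comp (continuous_pow 2).continuousOn
    fun s hs => ⟨sq_nonneg s, pow_le_one₀ hs.1 hs.2⟩

lemma integral_rpow_mul_one_sub_regIncBeta_sq {a z w : ℝ} (ha : 0 < a) (hz : 0 < z)
    (hw : 0 < w) :
    ∫ s in (0:ℝ)..1, s ^ (a - 1) * (1 - regIncBeta (s ^ 2) z w) =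
      betaFn (z + a / 2) w / (a * betaFn z w) := by
  have hza : 0 < z + a / 2 := by positivity
  have hB := (betaFn_pos hz hw).ne'
  have hreg : ContinuousOn (fun s : ℝ => 1 - regIncBeta (s ^ 2) z w) (Set.Icc 0 1) :=
    continuousOn_const.sub ((continuousOn_integral_rpow_mul_one_sub_rpow_sq hz hw).div_const _)
  rw [intervalIntegral.integral_eq_sub_of_hasDerivAt_of_le (f := fun s =>
    s ^ a * (1 - regIncBeta (s ^ 2) z w) / a +
      (∫ u in (0:ℝ)..s ^ 2, u ^ (z + a / 2 - 1) * (1 - u) ^ (w - 1)) / (a * betaFn z w))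
    zero_le_one]
  · simp only [regIncBeta, one_pow, integral_rpow_mul_one_sub_rpow hz hw,
      integral_rpow_mul_one_sub_rpow hza hw]
    simp [ha.ne', hB]
  · refine ContinuousOn.add ?_
      ((continuousOn_integral_rpow_mul_one_sub_rpow_sq hza hw).div_const _)
    exact ((Real.continuous_rpow_const ha.le).continuousOn.mul hreg).div_const _
  · intro s hs
    have hs2 : s ^ 2 ∈ Set.Ioo (0:ℝ) 1 := ⟨pow_pos hs.1 2, pow_lt_one₀ hs.1.le hs.2 two_ne_zero⟩
    have hsq : HasDerivAt (fun s : ℝ => s ^ 2) (2 * s) s := by simpa using hasDerivAt_pow 2 s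
    have hG := HasDerivAt.comp (h := fun s : ℝ => s ^ 2) s
      (hasDerivAt_integral_rpow_mul_one_sub_rpow hz hw hs2) hsq
    have hH := HasDerivAt.comp (h := fun s : ℝ => s ^ 2) s
      (hasDerivAt_integral_rpow_mul_one_sub_rpow hza hw hs2) hsq
    have hpow := Real.hasDerivAt_rpow_const (p := a) (Or.inl hs.1.ne')
    have hsplit : (s ^ 2) ^ (z + a / 2 - 1) = (s ^ 2) ^ (z - 1) * s ^ a := by
      rw [show z + a / 2 - 1 = (z - 1) + a / 2 by ring, Real.rpow_add hs2.1]
      congr 1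
      rw [← Real.rpow_natCast, ← Real.rpow_mul hs.1.le]
      congr 1
      push_cast
      ring
    convert! ((hpow.mul ((hG.div_const (betaFn z w)).const_sub 1)).div_const a).add
      (hH.div_const (a * betaFn z w)) using 1
    rw [hsplit]
    simp only [regIncBeta, Function.comp_apply]
    field_simp
    ring
  · refine (intervalIntegral.intervalIntegrable_rpow' (by linarith)).mul_continuousOn ?_
    rwa [Set.uIcc_of_le zero_le_one]

theorem stmt10 (d : ℕ) (hd : 2 ≤ d) (α : ℝ) (hα : α ∈ Set.Ioo (0:ℝ) 2) :
    α * (betaFn ((d:ℝ)/2 - α/2) (α/2) / betaFn ((d:ℝ)/2) (α/2)) *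
        (∫ s in (0:ℝ)..1, s ^ (α - 1) * (1 - regIncBeta (s^2) ((d:ℝ)/2 - α/2) (α/2)))
      = 1 := by
  obtain ⟨hα0, hα2⟩ := hα
  have hd' : (2:ℝ) ≤ d := by exact_mod_cast hd
  have hz : 0 < (d:ℝ)/2 - α/2 := by linarith
  have hw : 0 < α/2 := by linarith
  rw [integral_rpow_mul_one_sub_regIncBeta_sq hα0 hz hw, sub_add_cancel]
  have h₁ := (betaFn_pos hz hw).ne'
  have h₂ := (betaFn_pos (show 0 < (d:ℝ)/2 by linarith) hw).ne'
  generalize betaFn ((d:ℝ)/2 - α/2) (α/2) = b at *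
  field_simp
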